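/- arXiv:2412.19649 — 4 statements merged into one kernel-verified Lean document; each statement's English description precedes it below -/
import Mathlib

section
/- Let n ≥ 2 be a natural number, let K be a real number, and let j ≥ 1 be a natural number such that 2^j · log₂ n ≤ K. Define P_j = 1 − (1 − 1/K)^(2^j) (the probability that at least one of 2^j independent coins, each with bias 1/K toward heads, turns up heads). Then (2^j / K) · (1 − 1/(2 log₂ n)) < P_j < 2^j / K. -/
/-- Second-order Bonferroni-type upper bound complementing the Bernoulli inequality. -/
theorem one_sub_pow_le_quadratic {x : ℝ} (hx0 : 0 ≤ x) (hx1 : x ≤ 1) (m : ℕ) :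
    (1 - x) ^ m ≤ 1 - m * x + m * (m - 1) / 2 * x ^ 2 := by
  induction m with
  | zero => simp
  | succ m ih =>
    have hm : (0 : ℝ) ≤ m * (m - 1) := by
      rcases Nat.eq_zero_or_pos m with rfl | hm
      · simp
      · have : (1 : ℝ) ≤ m := by exact_mod_cast hm
        exact mul_nonneg (by linarith) (by linarith)
    have hstep := mul_le_mul_of_nonneg_right ih (sub_nonneg.2 hx1)
    have hcube : 0 ≤ (m : ℝ) * (m - 1) * x ^ 3 := by positivity
    rw [pow_succ]
    push_cast
    linarith

/-- **Lemma (bounds on P_j).** Let `n ≥ 2`, `K : ℝ`, `j ≥ 1` with `2^j · log₂ n ≤ K`.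
With `P_j = 1 − (1 − 1/K)^(2^j)`, we have
`(2^j / K) · (1 − 1/(2 log₂ n)) < P_j < 2^j / K`. -/
theorem bound_Pj (n : ℕ) (hn : 2 ≤ n) (K : ℝ) (j : ℕ) (hj : 1 ≤ j)
    (hK : (2 : ℝ) ^ j * Real.logb 2 n ≤ K) :
    (2 : ℝ) ^ j / K * (1 - 1 / (2 * Real.logb 2 n)) < 1 - (1 - 1 / K) ^ (2 ^ j) ∧
      1 - (1 - 1 / K) ^ (2 ^ j) < (2 : ℝ) ^ j / K := by
  have hL : 1 ≤ Real.logb 2 n := by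
    rw [Real.le_logb_iff_rpow_le one_lt_two (by positivity)]
    simpa using (show (2 : ℝ) ≤ n by exact_mod_cast hn)
  obtain ⟨m, hm⟩ : ∃ m : ℕ, m = 2 ^ j := ⟨_, rfl⟩
  have hmcast : (2 : ℝ) ^ j = m := by rw [hm]; push_cast; rfl
  have hm2 : 2 ≤ m := hm ▸ Nat.le_self_pow (by omega) 2
  have hm2' : (2 : ℝ) ≤ m := by exact_mod_cast hm2
  rw [hmcast] at hK ⊢
  rw [← hm]
  generalize Real.logb 2 n = L at hK hL
  have hKm : (m : ℝ) ≤ K := (le_mul_of_one_le_right (by positivity) hL).trans hK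
  have hKpos : 0 < K := by linarith
  have hx0 : 0 < 1 / K := by positivity
  have hx1 : 1 / K ≤ 1 := by rw [div_le_one hKpos]; linarith
  constructor
  · have hquad := one_sub_pow_le_quadratic hx0.le hx1 m
    have hmx : m * (1 / K) ≤ 1 / L := by
      rw [mul_one_div, div_le_div_iff₀ hKpos (by linarith)]
      linarith
    have hlt : m * (1 / K) * ((m - 1) * (1 / K)) < m * (1 / K) * (1 / L) :=
      mul_lt_mul_of_pos_left (by linarith) (by positivity)
    have hhalf : 1 / (2 * L) = 1 / L / 2 := by ring
    rw [hhalf, ← mul_one_div (m : ℝ) K]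
    linarith
  · have hbern := one_add_mul_self_lt_rpow_one_add (s := -(1 / K)) (p := m)
      (by linarith) (by linarith) (by linarith)
    rw [Real.rpow_natCast, ← sub_eq_add_neg 1 (1 / K)] at hbern
    rw [← mul_one_div (m : ℝ) K]
    linarith
end

section
/- Let n ≥ 1 be a natural number, V a finite set, and p : V × {1,…,n} → ℝ a function with 0 ≤ p(v,i) ≤ 1 for all v, i, and ∑_{i=1}^n p(v,i) ≥ 1 for every v ∈ V. Then there exists an index i ∈ {1,…,n} such that ∏_{v ∈ V} (1 − p(v,i)) ≤ (1 − 1/n)^{|V|}. -/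
/-- **AM-GM inequality** in the power form: a product of `n` nonnegative reals is at most the
`n`-th power of their average. -/
theorem prod_le_average_pow_card {ι : Type*} [Fintype ι] [Nonempty ι] (z : ι → ℝ)
    (hz : ∀ i, 0 ≤ z i) :
    ∏ i, z i ≤ ((∑ i, z i) / (Fintype.card ι : ℝ)) ^ Fintype.card ι := by
  have hcard : 0 < Fintype.card ι := Fintype.card_pos
  have amgm := Real.geom_mean_le_arith_mean Finset.univ (fun _ => (1 : ℝ)) z
    (fun _ _ => zero_le_one) (by simpa using hcard) (fun i _ => hz i)
  simp only [Real.rpow_one, one_mul, Finset.sum_const, Finset.card_univ, nsmul_eq_mul,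
    mul_one] at amgm
  have hprod : 0 ≤ ∏ i, z i := Finset.prod_nonneg fun i _ => hz i
  calc ∏ i, z i = ((∏ i, z i) ^ ((Fintype.card ι : ℝ)⁻¹)) ^ Fintype.card ι :=
        (Real.rpow_inv_natCast_pow hprod hcard.ne').symm
    _ ≤ _ := pow_le_pow_left₀ (Real.rpow_nonneg hprod _) amgm _

/-- **Existence of a frequently-skipped index.** Let `n ≥ 1`, `V` a finite set and
`p : V × {1,…,n} → ℝ` with `0 ≤ p v i ≤ 1` and `∑ᵢ p v i ≥ 1` for each `v`.
Then some index `i` satisfies `∏_{v} (1 − p v i) ≤ (1 − 1/n)^{|V|}`. -/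
theorem exists_index_prod_le (n : ℕ) (hn : 1 ≤ n) (V : Type*) [Fintype V]
    (p : V → Fin n → ℝ) (h0 : ∀ v i, 0 ≤ p v i) (h1 : ∀ v i, p v i ≤ 1)
    (hs : ∀ v, 1 ≤ ∑ i, p v i) :
    ∃ i : Fin n, ∏ v : V, (1 - p v i) ≤ (1 - 1 / (n : ℝ)) ^ (Fintype.card V) := by
  have : Nonempty (Fin n) := ⟨⟨0, hn⟩⟩
  have hn' : (0 : ℝ) < n := by exact_mod_cast hn
  have hc : 0 ≤ 1 - 1 / (n : ℝ) := by
    rw [sub_nonneg, div_le_one hn']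
    exact_mod_cast hn
  have hq : ∀ v i, 0 ≤ 1 - p v i := fun v i => sub_nonneg.2 (h1 v i)
  have hrow : ∀ v, ∏ i, (1 - p v i) ≤ (1 - 1 / (n : ℝ)) ^ n := by
    intro v
    have amgm := prod_le_average_pow_card (fun i => 1 - p v i) (hq v)
    rw [Fintype.card_fin] at amgm
    refine amgm.trans (pow_le_pow_left₀ ?_ ?_ n)
    · exact div_nonneg (Finset.sum_nonneg fun i _ => hq v i) hn'.le
    · rw [Finset.sum_sub_distrib, div_le_iff₀ hn', sub_mul, one_div_mul_cancel hn'.ne']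
      have sum_one : ∑ _i : Fin n, (1 : ℝ) = n := by simp
      linarith [hs v]
  obtain ⟨i, hi⟩ := Finite.exists_min fun i => ∏ v, (1 - p v i)
  refine ⟨i, le_of_pow_le_pow_left₀ (Nat.one_le_iff_ne_zero.1 hn) (pow_nonneg hc _) ?_⟩
  calc (∏ v, (1 - p v i)) ^ n = ∏ _j : Fin n, ∏ v, (1 - p v i) := by simp
    _ ≤ ∏ j, ∏ v, (1 - p v j) :=
        Finset.prod_le_prod (fun _ _ => Finset.prod_nonneg fun v _ => hq v i) fun j _ => hi j
    _ = ∏ v, ∏ j, (1 - p v j) := Finset.prod_comm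
    _ ≤ ∏ _v : V, (1 - 1 / (n : ℝ)) ^ n :=
        Finset.prod_le_prod (fun v _ => Finset.prod_nonneg fun j _ => hq v j) fun v _ => hrow v
    _ = ((1 - 1 / (n : ℝ)) ^ Fintype.card V) ^ n := by
        rw [Finset.prod_const, Finset.card_univ, pow_right_comm]
end

section
/- Let n ≥ 1 be a natural number, V a finite set with |V| = n, and p : V × {1,…,n} → ℝ a function with 0 ≤ p(v,i) ≤ 1 for all v, i, and ∑_{i=1}^n p(v,i) ≥ 1 for every v ∈ V. Then there exists an index ℓ ∈ {1,…,n} such that ∏_{v ∈ V} (1 − p(v,ℓ)) < e^{−1}; equivalently, the probability 1 − ∏_{v∈V}(1 − p(v,ℓ)) that at least one v skips index ℓ is at least 1 − e^{−1}. -/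
theorem prod_one_sub_lt_exp_neg_sum {ι : Type*} (s : Finset ι) (f : ι → ℝ)
    (hle : ∀ i ∈ s, f i ≤ 1) (hne : ∃ i ∈ s, f i ≠ 0) :
    ∏ i ∈ s, (1 - f i) < Real.exp (-∑ i ∈ s, f i) := by
  by_cases hone : ∃ i ∈ s, f i = 1
  · obtain ⟨i, hi, hfi⟩ := hone
    rw [Finset.prod_eq_zero hi (by rw [hfi, sub_self])]
    exact Real.exp_pos _
  · push Not at hone
    rw [← Finset.sum_neg_distrib, Real.exp_sum]
    refine Finset.prod_lt_prod
      (fun i hi => sub_pos.2 (lt_of_le_of_ne (hle i hi) (hone i hi)))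
      (fun i _ => Real.one_sub_le_exp_neg (f i)) ?_
    obtain ⟨i, hi, hfi⟩ := hne
    exact ⟨i, hi, Real.one_sub_lt_exp_neg hfi⟩

theorem exists_one_le_sum_of_one_le_sum {V ι : Type*} [Fintype V] [Fintype ι] [Nonempty ι]
    (hcard : Fintype.card ι ≤ Fintype.card V) (p : V → ι → ℝ) (hs : ∀ v, 1 ≤ ∑ i, p v i) :
    ∃ i, 1 ≤ ∑ v, p v i := by
  have htotal : ∑ _i : ι, (1 : ℝ) ≤ ∑ i, ∑ v, p v i := by
    rw [Finset.sum_comm]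
    calc ∑ _i : ι, (1 : ℝ) ≤ ∑ _v : V, (1 : ℝ) := by simpa using hcard
      _ ≤ ∑ v, ∑ i, p v i := Finset.sum_le_sum fun v _ => hs v
  obtain ⟨i, -, hi⟩ := Finset.exists_le_of_sum_le Finset.univ_nonempty htotal
  exact ⟨i, hi⟩

/-- **Existence of a defective index.** Let `n ≥ 1`, `V` a finite set with `|V| = n`,
and `p : V × {1,…,n} → ℝ` with `0 ≤ p v i ≤ 1` and `∑ᵢ p v i ≥ 1` for each `v`.
Then some index `ℓ` satisfies `∏_{v} (1 − p v ℓ) < e⁻¹`; equivalently the probability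
`1 − ∏_{v}(1 − p v ℓ)` that some `v` skips `ℓ` is at least `1 − e⁻¹`. -/
theorem exists_defective_index (n : ℕ) (hn : 1 ≤ n) (V : Type*) [Fintype V]
    (hV : Fintype.card V = n) (p : V → Fin n → ℝ)
    (h0 : ∀ v i, 0 ≤ p v i) (h1 : ∀ v i, p v i ≤ 1)
    (hs : ∀ v, 1 ≤ ∑ i, p v i) :
    ∃ ℓ : Fin n, ∏ v : V, (1 - p v ℓ) < Real.exp (-1) ∧
      1 - Real.exp (-1) ≤ 1 - ∏ v : V, (1 - p v ℓ) := by
  have : Nonempty (Fin n) := ⟨⟨0, hn⟩⟩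
  obtain ⟨ℓ, hℓ⟩ := exists_one_le_sum_of_one_le_sum (by simp [hV]) p hs
  have hne : ∃ v ∈ Finset.univ, p v ℓ ≠ 0 :=
    Finset.exists_ne_zero_of_sum_ne_zero (zero_lt_one.trans_le hℓ).ne'
  have hlt : ∏ v : V, (1 - p v ℓ) < Real.exp (-1) :=
    (prod_one_sub_lt_exp_neg_sum Finset.univ (p · ℓ) (fun v _ => h1 v ℓ) hne).trans_le
      (Real.exp_le_exp.2 (neg_le_neg hℓ))
  exact ⟨ℓ, hlt, sub_le_sub_left hlt.le 1⟩
end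

section
/- Let n be a natural number and let S be a nonempty finite set of Boolean strings of length n (i.e., functions from Fin n to Bool). Then there exists a set J of at most |S| − 1 indices in {1,…,n} such that distinct strings in S differ on some index of J; that is, the restriction map s ↦ s|_J is injective on S. In particular, any member of S is uniquely determined within S by its values on the indices of J. -/
/-- **Decision-tree lemma.** For a nonempty finite set `S` of Boolean strings of
length `n` there is a set `J` of at most `|S| − 1` indices such that distinct
strings of `S` differ on some index of `J`; i.e. the restriction to `J` is
injective on `S`. -/
theorem exists_distinguishing_indices (n : ℕ) (S : Finset (Fin n → Bool))
    (hS : S.Nonempty) :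
    ∃ J : Finset (Fin n), J.card ≤ S.card - 1 ∧
      ∀ s ∈ S, ∀ s' ∈ S, (∀ j ∈ J, s j = s' j) → s = s' := by
  induction hS using Finset.Nonempty.cons_induction with
  | singleton a => exact ⟨∅, by simp, by simp⟩
  | cons a S ha hS ih =>
    obtain ⟨J, hJ, hinj⟩ := ih
    have hpos := hS.card_pos
    obtain ⟨K, hJK, hK, hsep⟩ : ∃ K : Finset (Fin n), J ⊆ K ∧ K.card ≤ J.card + 1 ∧
        ∀ s ∈ S, ¬ ∀ j ∈ K, a j = s j := by
      by_cases h : ∃ b ∈ S, ∀ j ∈ J, a j = b j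
      · -- `b` is the only string of `S` that `J` fails to separate from `a`
        obtain ⟨b, hb, hab⟩ := h
        obtain ⟨i, hi⟩ := Function.ne_iff.mp (ne_of_mem_of_not_mem hb ha).symm
        refine ⟨insert i J, Finset.subset_insert i J, Finset.card_insert_le i J, ?_⟩
        intro s hs has
        have hsb : s = b := hinj s hs b hb fun j hj =>
          (has j (Finset.mem_insert_of_mem hj)).symm.trans (hab j hj)
        exact hi (hsb ▸ has i (Finset.mem_insert_self i J))
      · exact ⟨J, subset_rfl, Nat.le_succ _, fun s hs has => h ⟨s, hs, has⟩⟩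
    refine ⟨K, by rw [Finset.card_cons]; omega, ?_⟩
    intro s hs s' hs' hss
    rcases Finset.mem_cons.mp hs with rfl | hsS <;>
      rcases Finset.mem_cons.mp hs' with rfl | hsS'
    · rfl
    · exact (hsep s' hsS' hss).elim
    · exact (hsep s hsS fun j hj => (hss j hj).symm).elim
    · exact hinj s hsS s' hsS' fun j hj => hss j (hJK hj)
end
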